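/- Let φ : ℝ → ℝ be differentiable with |φ(t)| ≤ A (1 + |t|)^{-(N+1)} and |φ'(t)| ≤ A (1 + |t|)^{-(N+2)} for all t ∈ ℝ, where A > 0, and set K(x,y) := Σ_{k ∈ ℤ} 2^{kN} φ(2^k d(x,y)) for d(x,y) ≠ 0. Then for all x, x', y with d(x,y) ≠ 0 and d(x,x') ≤ (1/2) d(x,y), one has |K(x,y) − K(x',y)| ≤ C A · d(x,x') / d(x,y)^{N+1}, where C depends only on N. -/

import Mathlib

open MeasureTheory ENNReal

abbrev Euc (N : ℕ) := EuclideanSpace ℝ (Fin N)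

abbrev OrthG (N : ℕ) := Euc N ≃ₗᵢ[ℝ] Euc N

/-- `d(x,y) := min_{σ ∈ G} ‖x - σ(y)‖`. -/
noncomputable def refDist {N : ℕ} (G : Subgroup (OrthG N)) (x y : Euc N) : ℝ :=
  sInf {r : ℝ | ∃ σ ∈ G, r = ‖x - σ y‖}

section RefDist

variable {N : ℕ} (G : Subgroup (OrthG N))

lemma refDist_le {σ : OrthG N} (hσ : σ ∈ G) (x y : Euc N) : refDist G x y ≤ ‖x - σ y‖ :=
  csInf_le ⟨0, by rintro r ⟨τ, -, rfl⟩; exact norm_nonneg _⟩ ⟨σ, hσ, rfl⟩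

lemma refDist_nonneg (x y : Euc N) : 0 ≤ refDist G x y :=
  Real.sInf_nonneg (by rintro r ⟨τ, -, rfl⟩; exact norm_nonneg _)

lemma exists_refDist_eq [Finite G] (x y : Euc N) : ∃ σ ∈ G, refDist G x y = ‖x - σ y‖ := by
  have hfin : {r : ℝ | ∃ σ ∈ G, r = ‖x - σ y‖}.Finite := by
    refine (Set.finite_range fun σ : G => ‖x - (σ : OrthG N) y‖).subset ?_
    rintro r ⟨σ, hσ, rfl⟩
    exact ⟨⟨σ, hσ⟩, rfl⟩
  have hne : {r : ℝ | ∃ σ ∈ G, r = ‖x - σ y‖}.Nonempty := ⟨_, 1, G.one_mem, rfl⟩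
  exact hne.csInf_mem hfin

lemma refDist_triangle [Finite G] (x y z : Euc N) :
    refDist G x z ≤ refDist G x y + refDist G y z := by
  obtain ⟨σ, hσ, h₁⟩ := exists_refDist_eq G x y
  obtain ⟨τ, hτ, h₂⟩ := exists_refDist_eq G y z
  calc refDist G x z ≤ ‖x - (σ * τ) z‖ := refDist_le G (G.mul_mem hσ hτ) x z
    _ = ‖(x - σ y) + σ (y - τ z)‖ := by simp
    _ ≤ ‖x - σ y‖ + ‖σ (y - τ z)‖ := norm_add_le _ _
    _ = refDist G x y + refDist G y z := by rw [h₁, h₂, σ.norm_map]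

lemma refDist_comm_le [Finite G] (x y : Euc N) : refDist G y x ≤ refDist G x y := by
  obtain ⟨σ, hσ, h⟩ := exists_refDist_eq G x y
  calc refDist G y x ≤ ‖y - σ⁻¹ x‖ := refDist_le G (G.inv_mem hσ) y x
    _ = ‖σ (y - σ⁻¹ x)‖ := (σ.norm_map _).symm
    _ = ‖σ y - x‖ := by
      rw [map_sub, show σ (σ⁻¹ x) = x from σ.apply_symm_apply x]
    _ = refDist G x y := by rw [h, norm_sub_rev]

lemma abs_refDist_sub_le [Finite G] (x x' y : Euc N) :
    |refDist G x y - refDist G x' y| ≤ refDist G x x' := by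
  have h₁ := refDist_triangle G x x' y
  have h₂ := refDist_triangle G x' x y
  have h₃ := refDist_comm_le G x x'
  rw [abs_le]
  constructor <;> linarith

end RefDist

section DyadicSum

lemma summable_half_pow_natAbs : Summable fun k : ℤ => (1 / 2 : ℝ) ^ k.natAbs := by
  have h : Summable fun n : ℕ => (1 / 2 : ℝ) ^ n := summable_geometric_two
  exact Summable.of_nat_of_neg (by simpa using h) (by simpa using h)

lemma pow_div_one_add_pow_le_self {n : ℕ} (hn : 1 ≤ n) {v : ℝ} (hv : 0 < v) :
    v ^ n / (1 + v) ^ (n + 1) ≤ v := by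
  obtain ⟨m, rfl⟩ := Nat.exists_eq_add_of_le' hn
  rw [div_le_iff₀ (by positivity), pow_succ']
  have h₁ : v ^ m ≤ (1 + v) ^ m := by gcongr; linarith
  have h₂ : (1 + v) ^ m ≤ (1 + v) ^ (m + 1 + 1) := pow_le_pow_right₀ (by linarith) (by omega)
  gcongr
  exact h₁.trans h₂

lemma pow_div_one_add_pow_le_inv (n : ℕ) {v : ℝ} (hv : 0 < v) :
    v ^ n / (1 + v) ^ (n + 1) ≤ v⁻¹ := by
  rw [div_le_iff₀ (by positivity), inv_mul_eq_div, le_div_iff₀ hv, ← pow_succ]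
  gcongr
  linarith

lemma exists_dyadic_le_half_pow {s : ℝ} (hs : 0 < s) : ∃ m : ℤ, ∀ n : ℕ, 1 ≤ n → ∀ k : ℤ,
    ((2 : ℝ) ^ k) ^ n / (1 + (2 : ℝ) ^ k * s) ^ (n + 1)
      ≤ 2 / s ^ n * (1 / 2 : ℝ) ^ (k + m).natAbs := by
  obtain ⟨m, hm₁, hm₂⟩ := exists_mem_Ico_zpow hs (one_lt_two (α := ℝ))
  refine ⟨m, fun n hn k => ?_⟩
  have h2 : (2 : ℝ) ≠ 0 := two_ne_zero
  have hk : (0 : ℝ) < 2 ^ k := by positivity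
  have hv : 0 < (2 : ℝ) ^ k * s := by positivity
  have hlow : (2 : ℝ) ^ (k + m) ≤ 2 ^ k * s := by rw [zpow_add₀ h2]; gcongr
  have hup : (2 : ℝ) ^ k * s ≤ 2 * 2 ^ (k + m) := by
    have : (2 : ℝ) * 2 ^ (k + m) = 2 ^ k * 2 ^ (m + 1) := by
      rw [zpow_add₀ h2, zpow_add_one₀ h2]; ring
    rw [this]; gcongr
  have key : ((2 : ℝ) ^ k * s) ^ n / (1 + (2 : ℝ) ^ k * s) ^ (n + 1)
      ≤ 2 * (1 / 2 : ℝ) ^ (k + m).natAbs := by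
    obtain h | h := le_total 0 (k + m)
    · have e : (1 / 2 : ℝ) ^ (k + m).natAbs = ((2 : ℝ) ^ (k + m))⁻¹ := by
        rw [← zpow_natCast, Int.natAbs_of_nonneg h, one_div, inv_zpow]
      have hinv : ((2 : ℝ) ^ k * s)⁻¹ ≤ ((2 : ℝ) ^ (k + m))⁻¹ := by gcongr
      have hpos : (0 : ℝ) < ((2 : ℝ) ^ (k + m))⁻¹ := by positivity
      rw [e]
      linarith [pow_div_one_add_pow_le_inv n hv]
    · have e : (1 / 2 : ℝ) ^ (k + m).natAbs = (2 : ℝ) ^ (k + m) := by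
        rw [← zpow_natCast, Int.ofNat_natAbs_of_nonpos h, one_div, inv_zpow, zpow_neg, inv_inv]
      rw [e]
      exact (pow_div_one_add_pow_le_self hn hv).trans hup
  calc ((2 : ℝ) ^ k) ^ n / (1 + (2 : ℝ) ^ k * s) ^ (n + 1)
      = (((2 : ℝ) ^ k * s) ^ n / (1 + (2 : ℝ) ^ k * s) ^ (n + 1)) / s ^ n := by
        rw [mul_pow]; field_simp
    _ ≤ 2 * (1 / 2 : ℝ) ^ (k + m).natAbs / s ^ n := by gcongr
    _ = _ := by ring

lemma summable_dyadic {n : ℕ} (hn : 1 ≤ n) {s : ℝ} (hs : 0 < s) :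
    Summable fun k : ℤ => ((2 : ℝ) ^ k) ^ n / (1 + (2 : ℝ) ^ k * s) ^ (n + 1) := by
  obtain ⟨m, hm⟩ := exists_dyadic_le_half_pow hs
  refine Summable.of_nonneg_of_le (fun k => by positivity) (hm n hn) (Summable.mul_left _ ?_)
  exact summable_half_pow_natAbs.comp_injective (add_left_injective m)

lemma tsum_dyadic_le {n : ℕ} (hn : 1 ≤ n) {s : ℝ} (hs : 0 < s) :
    ∑' k : ℤ, ((2 : ℝ) ^ k) ^ n / (1 + (2 : ℝ) ^ k * s) ^ (n + 1)
      ≤ 2 / s ^ n * ∑' k : ℤ, (1 / 2 : ℝ) ^ k.natAbs := by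
  obtain ⟨m, hm⟩ := exists_dyadic_le_half_pow hs
  have hsum : Summable fun k : ℤ => (1 / 2 : ℝ) ^ (k + m).natAbs :=
    summable_half_pow_natAbs.comp_injective (add_left_injective m)
  calc _ ≤ ∑' k : ℤ, 2 / s ^ n * (1 / 2 : ℝ) ^ (k + m).natAbs :=
        (summable_dyadic hn hs).tsum_le_tsum (hm n hn) (hsum.mul_left _)
    _ = 2 / s ^ n * ∑' k : ℤ, (1 / 2 : ℝ) ^ (k + m).natAbs := tsum_mul_left
    _ = _ := by
      rw [← (Equiv.addRight m).tsum_eq fun k : ℤ => (1 / 2 : ℝ) ^ k.natAbs]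
      rfl

end DyadicSum

section Profile

variable {A : ℝ} {φ : ℝ → ℝ}

lemma summable_dyadic_profile {n : ℕ} (hn : 1 ≤ n)
    (hφ : ∀ t : ℝ, |φ t| ≤ A / (1 + |t|) ^ (n + 1)) {s : ℝ} (hs : 0 < s) :
    Summable fun k : ℤ => (2 : ℝ) ^ (k * (n : ℤ)) * φ ((2 : ℝ) ^ k * s) := by
  refine Summable.of_norm_bounded ((summable_dyadic hn hs).mul_left A) fun k => ?_
  have hv : 0 < (2 : ℝ) ^ k * s := by positivity
  have h := hφ ((2 : ℝ) ^ k * s)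
  rw [abs_of_pos hv] at h
  rw [zpow_mul, zpow_natCast, Real.norm_eq_abs, abs_mul,
    abs_of_pos (show (0 : ℝ) < (2 ^ k) ^ n by positivity)]
  calc _ ≤ ((2 : ℝ) ^ k) ^ n * (A / (1 + 2 ^ k * s) ^ (n + 1)) := by gcongr
    _ = _ := by ring

lemma abs_sub_le_of_abs_deriv_le {n : ℕ} (hA : 0 ≤ A) (hd : Differentiable ℝ φ)
    (hφ : ∀ t : ℝ, |deriv φ t| ≤ A / (1 + |t|) ^ n) {a b u : ℝ} (hu : 0 ≤ u)
    (ha : u ≤ a) (hb : u ≤ b) : |φ a - φ b| ≤ A / (1 + u) ^ n * |a - b| := by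
  refine (convex_Ici u).norm_image_sub_le_of_norm_deriv_le (fun t _ => hd t) (fun t ht => ?_) hb ha
  refine (hφ t).trans ?_
  have : u ≤ |t| := le_trans ht (le_abs_self t)
  gcongr

lemma abs_tsum_dyadic_sub_le {n : ℕ} (hn : 1 ≤ n) (hA : 0 ≤ A) (hd : Differentiable ℝ φ)
    (hφ : ∀ t : ℝ, |φ t| ≤ A / (1 + |t|) ^ (n + 1))
    (hφ' : ∀ t : ℝ, |deriv φ t| ≤ A / (1 + |t|) ^ (n + 2))
    {r s s' : ℝ} (hr : 0 < r) (hs : r ≤ s) (hs' : r ≤ s') :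
    |(∑' k : ℤ, (2 : ℝ) ^ (k * (n : ℤ)) * φ ((2 : ℝ) ^ k * s)) -
        ∑' k : ℤ, (2 : ℝ) ^ (k * (n : ℤ)) * φ ((2 : ℝ) ^ k * s')|
      ≤ A * |s - s'| * (2 / r ^ (n + 1) * ∑' k : ℤ, (1 / 2 : ℝ) ^ k.natAbs) := by
  rw [← (summable_dyadic_profile hn hφ (hr.trans_le hs)).tsum_sub
    (summable_dyadic_profile hn hφ (hr.trans_le hs')), ← Real.norm_eq_abs]
  have hsum := summable_dyadic (n := n + 1) (by omega) hr
  refine le_trans (tsum_of_norm_bounded (hsum.mul_left (A * |s - s'|)).hasSum fun k => ?_) ?_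
  · have hk : (0 : ℝ) < 2 ^ k := by positivity
    have h := abs_sub_le_of_abs_deriv_le (a := 2 ^ k * s) (b := 2 ^ k * s') (u := 2 ^ k * r)
      hA hd hφ' (by positivity) (by gcongr) (by gcongr)
    rw [← mul_sub, abs_mul, abs_of_pos hk] at h
    rw [zpow_mul, zpow_natCast, ← mul_sub, Real.norm_eq_abs, abs_mul,
      abs_of_pos (show (0 : ℝ) < (2 ^ k) ^ n by positivity)]
    calc _ ≤ ((2 : ℝ) ^ k) ^ n * (A / (1 + 2 ^ k * r) ^ (n + 2) * (2 ^ k * |s - s'|)) := by gcongr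
      _ = _ := by ring
  · rw [tsum_mul_left]
    gcongr
    exact tsum_dyadic_le (by omega) hr

end Profile

/-- smoothness estimate in the first variable for the dyadic kernel
`K(x,y) = Σ_k 2^{kN} φ(2^k d(x,y))`. -/
theorem stmt_5 (N : ℕ) (hN : 1 ≤ N) :
    ∃ C : ℝ, 0 < C ∧
      ∀ (G : Subgroup (OrthG N)), Finite G →
      ∀ (A : ℝ) (φ : ℝ → ℝ), 0 < A → Differentiable ℝ φ →
        (∀ t : ℝ, |φ t| ≤ A / (1 + |t|) ^ (N + 1)) →
        (∀ t : ℝ, |deriv φ t| ≤ A / (1 + |t|) ^ (N + 2)) →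
        ∀ x x' y : Euc N, refDist G x y ≠ 0 →
          refDist G x x' ≤ (1/2) * refDist G x y →
          |(∑' k : ℤ, (2:ℝ) ^ (k * (N : ℤ)) * φ ((2:ℝ) ^ k * refDist G x y)) -
            (∑' k : ℤ, (2:ℝ) ^ (k * (N : ℤ)) * φ ((2:ℝ) ^ k * refDist G x' y))|
            ≤ C * A * refDist G x x' / refDist G x y ^ (N + 1) := by
  have hS : 0 < ∑' k : ℤ, (1 / 2 : ℝ) ^ k.natAbs :=
    summable_half_pow_natAbs.tsum_pos (fun k => by positivity) 0 (by positivity)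
  refine ⟨2 ^ (N + 2) * ∑' k : ℤ, (1 / 2 : ℝ) ^ k.natAbs, by positivity, ?_⟩
  intro G _ A φ hA hd hφ hφ' x x' y hxy hle
  have hs : 0 < refDist G x y := lt_of_le_of_ne (refDist_nonneg G x y) (Ne.symm hxy)
  have hdist := abs_refDist_sub_le G x x' y
  have hs' : refDist G x y / 2 ≤ refDist G x' y := by linarith [(abs_le.mp hdist).2]
  calc _ ≤ A * |refDist G x y - refDist G x' y| *
        (2 / (refDist G x y / 2) ^ (N + 1) * ∑' k : ℤ, (1 / 2 : ℝ) ^ k.natAbs) :=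
        abs_tsum_dyadic_sub_le hN hA.le hd hφ hφ' (half_pos hs) (half_le_self hs.le) hs'
    _ ≤ A * refDist G x x' *
        (2 / (refDist G x y / 2) ^ (N + 1) * ∑' k : ℤ, (1 / 2 : ℝ) ^ k.natAbs) := by gcongr
    _ = _ := by
      rw [div_pow]
      field_simp
      ring
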